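/- Let H > 0 be real, D_H(r) = (r²−1)² + 4H²(r²+1)², e^{2α_H}(r) = 16(1+4H²)(1+r²)²/D_H(r)², and define for r > 0: ρ(r) = 4r/√(D_H(r)), h(r) = ((1+4H²)/(4H²)) ( −4H(1 − r² + 4H²(1+r²)) / ( (r²−1)² + 16H⁴(1+r²)² + 8H²(1+r⁴) ) + arctan( (r² − 1 + 4H²(r²+1))/(4H) ) ), and ψ(r) = arctan( (4H² − 1 + (1+4H²)r²)/(4H) ). Then ρ, h, ψ are differentiable on (0,∞) and for every r > 0: (i) ρ(r)² + ρ(r)⁴/4 = r² e^{2α_H}(r); (ii) (2ρ(r)² + ρ(r)⁴/2) ψ′(r) − ρ(r)² h′(r) = 0; (iii) h′(r)² + ρ′(r)² + ρ(r)² ψ′(r)² + (1/4) ρ(r)⁴ ψ′(r)² − ρ(r)² h′(r) ψ′(r) = e^{2α_H}(r). -/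

import Mathlib

open Real

/-- `D_H(r) = (r²−1)² + 4H²(r²+1)²`. -/
noncomputable def nilD (H r : ℝ) : ℝ := (r ^ 2 - 1) ^ 2 + 4 * H ^ 2 * (r ^ 2 + 1) ^ 2

/-- The conformal metric factor `e^{2α_H}(r) = 16(1+4H²)(1+r²)²/D_H(r)²` of the cmc
sphere `S_H`. -/
noncomputable def nilMetric (H r : ℝ) : ℝ :=
  16 * (1 + 4 * H ^ 2) * (1 + r ^ 2) ^ 2 / (nilD H r) ^ 2

/-- The radial component `ρ(r)` of the generating curve of `S_H`. -/
noncomputable def nilRho (H r : ℝ) : ℝ := 4 * r / Real.sqrt (nilD H r)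

/-- The height component `h(r)` of the generating curve of `S_H`. -/
noncomputable def nilHeight (H r : ℝ) : ℝ :=
  (1 + 4 * H ^ 2) / (4 * H ^ 2) *
    (-(4 * H * (1 - r ^ 2 + 4 * H ^ 2 * (1 + r ^ 2))) /
        ((r ^ 2 - 1) ^ 2 + 16 * H ^ 4 * (1 + r ^ 2) ^ 2 + 8 * H ^ 2 * (1 + r ^ 4)) +
      arctan ((r ^ 2 - 1 + 4 * H ^ 2 * (r ^ 2 + 1)) / (4 * H)))

/-- The angular component `ψ(r)` of the generating curve of `S_H`. -/
noncomputable def nilAngle (H r : ℝ) : ℝ :=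
  arctan ((4 * H ^ 2 - 1 + (1 + 4 * H ^ 2) * r ^ 2) / (4 * H))

theorem nilD_pos {H r : ℝ} (hH : 0 < H) : 0 < nilD H r := by
  unfold nilD
  have h₁ : 0 < 4 * H ^ 2 * (r ^ 2 + 1) ^ 2 := by positivity
  linarith [sq_nonneg (r ^ 2 - 1)]

theorem hasDerivAt_nilD (H r : ℝ) :
    HasDerivAt (nilD H) (4 * r * (r ^ 2 - 1 + 4 * H ^ 2 * (r ^ 2 + 1))) r := by
  have h₂ : HasDerivAt (fun x : ℝ => x ^ 2) (2 * r) r := by simpa using hasDerivAt_pow 2 r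
  have h := ((h₂.sub_const 1).pow 2).add (((h₂.add_const 1).pow 2).const_mul (4 * H ^ 2))
  refine h.congr_deriv ?_
  push_cast
  ring

theorem hasDerivAt_nilRho {H : ℝ} (hH : 0 < H) (r : ℝ) :
    HasDerivAt (nilRho H)
      (4 * (1 + 4 * H ^ 2) * (1 - r ^ 4) / (nilD H r * √(nilD H r))) r := by
  have hD := nilD_pos (r := r) hH
  have hs : √(nilD H r) ^ 2 = nilD H r := Real.sq_sqrt hD.le
  have hs₀ : √(nilD H r) ≠ 0 := (Real.sqrt_pos.2 hD).ne'
  have h := ((hasDerivAt_id r).const_mul 4).div ((hasDerivAt_nilD H r).sqrt hD.ne') hs₀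
  refine h.congr_deriv ?_
  have hD₀ := hD.ne'
  simp only [id]
  rw [hs]
  field_simp
  rw [hs]
  unfold nilD
  ring

theorem hasDerivAt_nilAngle {H : ℝ} (hH : 0 < H) (r : ℝ) :
    HasDerivAt (nilAngle H) (8 * H * r / nilD H r) r := by
  have hD := nilD_pos (r := r) hH
  have h₂ : HasDerivAt (fun x : ℝ => x ^ 2) (2 * r) r := by simpa using hasDerivAt_pow 2 r
  have h := (((h₂.const_mul (1 + 4 * H ^ 2)).const_add (4 * H ^ 2 - 1)).div_const (4 * H)).arctan
  refine h.congr_deriv ?_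
  have hE : 1 + ((4 * H ^ 2 - 1 + (1 + 4 * H ^ 2) * r ^ 2) / (4 * H)) ^ 2 =
      (1 + 4 * H ^ 2) * nilD H r / (16 * H ^ 2) := by
    unfold nilD
    field_simp
    ring
  rw [hE]
  field_simp
  ring

theorem nilHeight_eq (H r : ℝ) :
    nilHeight H r = (1 + 4 * H ^ 2) / (4 * H ^ 2) *
      (-(4 * H * (1 - r ^ 2 + 4 * H ^ 2 * (1 + r ^ 2))) / ((1 + 4 * H ^ 2) * nilD H r) +
        nilAngle H r) := by
  unfold nilHeight nilAngle nilD
  congr 3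
  · ring
  · ring_nf

theorem hasDerivAt_nilHeight {H : ℝ} (hH : 0 < H) (r : ℝ) :
    HasDerivAt (nilHeight H)
      (16 * H * r * (1 + 4 * H ^ 2) * (1 + r ^ 2) ^ 2 / nilD H r ^ 2) r := by
  have hD := nilD_pos (r := r) hH
  have h₂ : HasDerivAt (fun x : ℝ => x ^ 2) (2 * r) r := by simpa using hasDerivAt_pow 2 r
  have hK : 1 + 4 * H ^ 2 ≠ 0 := by positivity
  have hnum := (((h₂.const_sub 1).add ((h₂.const_add 1).const_mul (4 * H ^ 2))).const_mul
    (4 * H)).neg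
  have h := ((hnum.div ((hasDerivAt_nilD H r).const_mul (1 + 4 * H ^ 2))
    (mul_ne_zero hK hD.ne')).add (hasDerivAt_nilAngle hH r)).const_mul
      ((1 + 4 * H ^ 2) / (4 * H ^ 2))
  refine (h.congr_of_eventuallyEq (.of_forall (nilHeight_eq H))).congr_deriv ?_
  have hD₀ := hD.ne'
  simp only [Pi.neg_apply, Pi.add_apply]
  field_simp
  unfold nilD
  ring

theorem nilRho_sq {H : ℝ} (hH : 0 < H) (r : ℝ) : nilRho H r ^ 2 = 16 * r ^ 2 / nilD H r := by
  rw [nilRho, div_pow, Real.sq_sqrt (nilD_pos hH).le]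
  ring

/-- The generating curve `(ρ(r), ψ(r), h(r))` of the cmc sphere `S_H` solves the
system of equations expressing that the induced metric on the corresponding
surface of revolution in the Heisenberg group has the conformal form
`e^{2α_H}(dr² + r²dθ²)`. -/
theorem generating_curve_solves_conformality_system (H : ℝ) (hH : 0 < H) :
    (∀ r ∈ Set.Ioi (0 : ℝ), DifferentiableAt ℝ (nilRho H) r) ∧
    (∀ r ∈ Set.Ioi (0 : ℝ), DifferentiableAt ℝ (nilHeight H) r) ∧
    (∀ r ∈ Set.Ioi (0 : ℝ), DifferentiableAt ℝ (nilAngle H) r) ∧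
    ∀ r ∈ Set.Ioi (0 : ℝ),
      (nilRho H r) ^ 2 + (nilRho H r) ^ 4 / 4 = r ^ 2 * nilMetric H r ∧
      (2 * (nilRho H r) ^ 2 + (nilRho H r) ^ 4 / 2) * deriv (nilAngle H) r -
        (nilRho H r) ^ 2 * deriv (nilHeight H) r = 0 ∧
      (deriv (nilHeight H) r) ^ 2 + (deriv (nilRho H) r) ^ 2 +
        (nilRho H r) ^ 2 * (deriv (nilAngle H) r) ^ 2 +
        1 / 4 * (nilRho H r) ^ 4 * (deriv (nilAngle H) r) ^ 2 -
        (nilRho H r) ^ 2 * deriv (nilHeight H) r * deriv (nilAngle H) r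
      = nilMetric H r := by
  refine ⟨fun r _ => (hasDerivAt_nilRho hH r).differentiableAt,
    fun r _ => (hasDerivAt_nilHeight hH r).differentiableAt,
    fun r _ => (hasDerivAt_nilAngle hH r).differentiableAt, fun r _ => ?_⟩
  have hD := nilD_pos (r := r) hH
  have hD₀ := hD.ne'
  have h₄ : nilRho H r ^ 4 = (16 * r ^ 2 / nilD H r) ^ 2 := by
    rw [← nilRho_sq hH]
    ring
  have hρ' : (4 * (1 + 4 * H ^ 2) * (1 - r ^ 4) / (nilD H r * √(nilD H r))) ^ 2 =
      16 * (1 + 4 * H ^ 2) ^ 2 * (1 - r ^ 4) ^ 2 / nilD H r ^ 3 := by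
    rw [div_pow, mul_pow (nilD H r), Real.sq_sqrt hD.le]
    ring
  rw [(hasDerivAt_nilRho hH r).deriv, (hasDerivAt_nilHeight hH r).deriv,
    (hasDerivAt_nilAngle hH r).deriv, h₄, nilRho_sq hH, hρ', nilMetric]
  refine ⟨?_, ?_, ?_⟩ <;>
  · field_simp
    unfold nilD
    ring
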